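/- Let a ≥ 1 and n ≥ 1 be integers and let k be an integer with k ≥ n(a+1). Then n times the number of n-element subsets S of ℤ/kℤ with the property that for all distinct x, y ∈ S and every integer r with 1 ≤ r ≤ a one has x − y ≠ r in ℤ/kℤ (equivalently, every two distinct elements of S are at cyclic distance greater than a) equals k · binom(k − n·a − 1, n − 1), where binom denotes the usual binomial coefficient of natural numbers. -/

import Mathlib

/-- subsets of `range m` with `j` elements and gaps larger than `a` -/
def linSets (a m j : ℕ) : Finset (Finset ℕ) :=
  ((Finset.range m).powersetCard j).filter (fun T => ∀ x ∈ T, ∀ y ∈ T, x < y → x + a < y)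

theorem mem_linSets (a m j : ℕ) (T : Finset ℕ) : T ∈ linSets a m j ↔
    (∀ x ∈ T, x < m) ∧ T.card = j ∧ ∀ x ∈ T, ∀ y ∈ T, x < y → x + a < y := by
  simp [linSets, Finset.mem_powersetCard, Finset.subset_iff, and_assoc]

theorem linSets_zero (a m : ℕ) : (linSets a m 0).card = 1 := by
  rw [Finset.card_eq_one]
  refine ⟨∅, ?_⟩
  ext T
  rw [mem_linSets, Finset.mem_singleton]
  constructor
  · rintro ⟨_, h, _⟩
    exact Finset.card_eq_zero.mp h
  · rintro rfl
    simp

theorem linSets_rec (a m j : ℕ) :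
    (linSets a (m + 1) (j + 1)).card = (linSets a m (j + 1)).card + (linSets a (m - a) j).card := by
  classical
  rw [← Finset.card_filter_add_card_filter_not (s := linSets a (m + 1) (j + 1)) (fun T => m ∉ T)]
  congr 1
  · congr 1
    ext T
    simp only [Finset.mem_filter, mem_linSets]
    constructor
    · rintro ⟨⟨h1, h2, h3⟩, h4⟩
      refine ⟨fun x hx => ?_, h2, h3⟩
      have := h1 x hx
      have : x ≠ m := by rintro rfl; exact h4 hx
      omega
    · rintro ⟨h1, h2, h3⟩
      refine ⟨⟨fun x hx => ?_, h2, h3⟩, fun h => ?_⟩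
      · have := h1 x hx
        omega
      · have := h1 m h
        omega
  · refine Finset.card_bij' (fun T _ => T.erase m) (fun T _ => insert m T) ?_ ?_ ?_ ?_
    · intro T hT
      simp only [Finset.mem_filter, mem_linSets, not_not] at hT ⊢
      obtain ⟨⟨h1, h2, h3⟩, h4⟩ := hT
      refine ⟨fun x hx => ?_, ?_, ?_⟩
      · rw [Finset.mem_erase] at hx
        have h5 := h1 x hx.2
        have := h3 x hx.2 m h4 (by omega)
        omega
      · rw [Finset.card_erase_of_mem h4, h2]; rfl
      · intro x hx y hy
        exact h3 x (Finset.mem_of_mem_erase hx) y (Finset.mem_of_mem_erase hy)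
    · intro T hT
      simp only [Finset.mem_filter, mem_linSets, not_not] at hT ⊢
      obtain ⟨h1, h2, h3⟩ := hT
      refine ⟨⟨?_, ?_, ?_⟩, Finset.mem_insert_self _ _⟩
      · intro x hx
        rcases Finset.mem_insert.mp hx with rfl | hx
        · omega
        · have := h1 x hx
          omega
      · rw [Finset.card_insert_of_notMem, h2]
        intro h
        have := h1 m h
        omega
      · intro x hx y hy hxy
        rcases Finset.mem_insert.mp hx with hx1 | hx1 <;>
          rcases Finset.mem_insert.mp hy with hy1 | hy1
        · omega
        · have := h1 y hy1
          omega
        · have := h1 x hx1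
          omega
        · exact h3 x hx1 y hy1 hxy
    · intro T hT
      simp only [Finset.mem_filter, not_not] at hT
      exact Finset.insert_erase hT.2
    · intro T hT
      rw [mem_linSets] at hT
      apply Finset.erase_insert
      intro h
      have := hT.1 m h
      omega

theorem choose_rec (a m j : ℕ) : (m + 1 + a - (j + 1) * a).choose (j + 1) =
    (m + a - (j + 1) * a).choose (j + 1) + (m - a + a - j * a).choose j := by
  have e1 : m + 1 + a - (j + 1) * a = m + 1 - j * a := by
    rw [add_mul, one_mul]; omega
  have e2 : m + a - (j + 1) * a = m - j * a := by
    rw [add_mul, one_mul]; omega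
  rw [e1, e2]
  rcases Nat.eq_zero_or_pos j with rfl | hj
  · simp
  · have hle : a ≤ j * a := Nat.le_mul_of_pos_left a hj
    have e3 : m - a + a - j * a = m - j * a := by omega
    rw [e3]
    by_cases h : j * a ≤ m
    · have e4 : m + 1 - j * a = (m - j * a) + 1 := by omega
      rw [e4, Nat.choose_succ_succ, add_comm]
    · have e4 : m + 1 - j * a = 0 := by omega
      have e5 : m - j * a = 0 := by omega
      rw [e4, e5, Nat.choose_eq_zero_of_lt (by omega : 0 < j), Nat.choose_eq_zero_of_lt (by omega : 0 < j + 1)]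

theorem linSets_card (a : ℕ) : ∀ m j, (linSets a m j).card = (m + a - j * a).choose j := by
  intro m
  induction m using Nat.strong_induction_on with
  | _ m ih =>
    intro j
    cases j with
    | zero => rw [linSets_zero]; simp
    | succ j =>
      cases m with
      | zero =>
        have e : 0 + a - (j + 1) * a = 0 := by
          rw [add_mul, one_mul]; omega
        rw [e, Nat.choose_zero_succ, Finset.card_eq_zero, Finset.eq_empty_iff_forall_notMem]
        intro T hT
        rw [mem_linSets] at hT
        have : T = ∅ := Finset.eq_empty_iff_forall_notMem.mpr
          (fun x hx => by have := hT.1 x hx; omega)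
        rw [this] at hT
        simp at hT
      | succ m =>
        rw [linSets_rec, ih m (by omega), ih (m - a) (by omega), choose_rec]

def Good (a k : ℕ) (S : Finset (ZMod k)) : Prop :=
  ∀ x ∈ S, ∀ y ∈ S, x ≠ y → ∀ r : ℕ, 1 ≤ r → r ≤ a → x - y ≠ (r : ZMod k)

theorem cast_inj_lt {k x y : ℕ} (hx : x < k) (hy : y < k) (h : (x : ZMod k) = y) : x = y := by
  rw [ZMod.natCast_eq_natCast_iff] at h
  exact Nat.ModEq.eq_of_lt_of_lt h hx hy

theorem cast_sub_ne {a k x y : ℕ} (hx : x < k) (hxy : x < y → x + a < y)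
    (hyx : y < x → y + a < x) (hw : y + a < x + k) (r : ℕ) (h1 : 1 ≤ r) (h2 : r ≤ a) :
    (x : ZMod k) - y ≠ (r : ZMod k) := by
  intro h
  rw [sub_eq_iff_eq_add, ← Nat.cast_add, ZMod.natCast_eq_natCast_iff] at h
  by_cases hc : r + y < k
  · have := Nat.ModEq.eq_of_lt_of_lt h hx hc
    omega
  · have h' : x + k ≡ r + y [MOD k] := by
      simpa [Nat.ModEq] using h
    have h'' : x ≡ r + y - k [MOD k] := by
      have e : r + y = (r + y - k) + k := by omega
      rw [e] at h
      simpa [Nat.ModEq] using h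
    by_cases hd : r + y - k < k
    · have := Nat.ModEq.eq_of_lt_of_lt h'' hx hd
      omega
    · omega

theorem zero_card (a n k : ℕ) (hn : 1 ≤ n) (hk : n * (a + 1) ≤ k) [NeZero k]
    (G : Finset (Finset (ZMod k))) (hG : ∀ S, S ∈ G ↔ (S.card = n ∧ Good a k S) ∧ 0 ∈ S) :
    G.card = (linSets a (k - 1 - 2 * a) (n - 1)).card := by
  classical
  symm
  have hak : a + 1 ≤ k := le_trans (Nat.le_mul_of_pos_left _ hn) hk
  have key : ∀ T ∈ linSets a (k - 1 - 2 * a) (n - 1), ∀ t ∈ T, t + (a + 1) + a < k := by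
    intro T hT t ht
    have := ((mem_linSets _ _ _ _).mp hT).1 t ht
    omega
  have hcast0 : ∀ t : ℕ, t + (a + 1) < k → ((t + (a + 1) : ℕ) : ZMod k) ≠ 0 := by
    intro t ht h
    have := cast_inj_lt ht (y := 0) (by omega) (by simpa using h)
    omega
  refine Finset.card_bij (fun T _ => insert 0 (T.image (fun t => ((t + (a + 1) : ℕ) : ZMod k)))) ?_ ?_ ?_
  · intro T hT
    have hkey := key T hT
    obtain ⟨h1, h2, h3⟩ := (mem_linSets _ _ _ _).mp hT
    rw [hG]
    refine ⟨⟨?_, ?_⟩, Finset.mem_insert_self _ _⟩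
    · rw [Finset.card_insert_of_notMem, Finset.card_image_of_injOn, h2]
      · omega
      · intro s hs t ht hst
        have hs' := hkey s hs
        have ht' := hkey t ht
        have := cast_inj_lt (by omega) (by omega) hst
        omega
      · intro h
        obtain ⟨t, ht, h⟩ := Finset.mem_image.mp h
        have ht' := hkey t ht
        exact hcast0 t (by omega) h
    · intro x hx y hy hxy r hr1 hr2
      rcases Finset.mem_insert.mp hx with rfl | hx <;> rcases Finset.mem_insert.mp hy with rfl | hy
      · exact absurd rfl hxy
      · obtain ⟨t, ht, rfl⟩ := Finset.mem_image.mp hy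
        have ht' := hkey t ht
        have := cast_sub_ne (a := a) (k := k) (x := 0) (y := t + (a + 1)) (by omega) (by omega) (by omega) (by omega) r hr1 hr2
        simpa using this
      · obtain ⟨t, ht, rfl⟩ := Finset.mem_image.mp hx
        have ht' := hkey t ht
        have := cast_sub_ne (a := a) (k := k) (x := t + (a + 1)) (y := 0) (by omega) (by omega) (by omega) (by omega) r hr1 hr2
        simpa using this
      · obtain ⟨s, hs, rfl⟩ := Finset.mem_image.mp hx
        obtain ⟨t, ht, rfl⟩ := Finset.mem_image.mp hy
        have hs' := hkey s hs
        have ht' := hkey t ht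
        have h4 := h3 s hs t ht
        have h5 := h3 t ht s hs
        exact cast_sub_ne (by omega) (by omega) (by omega) (by omega) r hr1 hr2
  · have aux : ∀ T hT, ∀ U hU, (fun T (_ : T ∈ linSets a (k - 1 - 2 * a) (n - 1)) => insert 0 (T.image (fun t => ((t + (a + 1) : ℕ) : ZMod k)))) T hT = (fun T (_ : T ∈ linSets a (k - 1 - 2 * a) (n - 1)) => insert 0 (T.image (fun t => ((t + (a + 1) : ℕ) : ZMod k)))) U hU → T ⊆ U := by
      intro T hT U hU h t ht
      have ht' := key T hT t ht
      have hm : ((t + (a + 1) : ℕ) : ZMod k) ∈ insert 0 (U.image (fun t => ((t + (a + 1) : ℕ) : ZMod k))) := by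
        have h' : insert 0 (T.image (fun t => ((t + (a + 1) : ℕ) : ZMod k))) = insert 0 (U.image (fun t => ((t + (a + 1) : ℕ) : ZMod k))) := h
        rw [← h']
        exact Finset.mem_insert_of_mem (Finset.mem_image_of_mem (fun t => ((t + (a + 1) : ℕ) : ZMod k)) ht)
      rcases Finset.mem_insert.mp hm with hm | hm
      · exact absurd hm (hcast0 t (by omega))
      · obtain ⟨u, hu, hut⟩ := Finset.mem_image.mp hm
        have hu' := key U hU u hu
        have := cast_inj_lt (by omega) (by omega) hut
        have : u = t := by omega
        rwa [← this]
    intro T hT U hU h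
    exact Finset.Subset.antisymm (aux T hT U hU h) (aux U hU T hT h.symm)
  · intro S hS
    obtain ⟨⟨hc, hg⟩, h0⟩ := (hG S).mp hS
    have hv : ∀ x ∈ S, x ≠ 0 → a + 1 ≤ x.val ∧ x.val + a < k := by
      intro x hx hx0
      have hxv : ((x.val : ℕ) : ZMod k) = x := ZMod.natCast_zmod_val x
      have hpos : x.val ≠ 0 := by simpa [ZMod.val_eq_zero] using hx0
      have hlt := ZMod.val_lt x
      constructor
      · by_contra hcon
        exact hg x hx 0 h0 hx0 x.val (by omega) (by omega) (by rw [hxv, sub_zero])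
      · by_contra hcon
        refine hg 0 h0 x hx hx0.symm (k - x.val) (by omega) (by omega) ?_
        rw [Nat.cast_sub hlt.le, hxv]
        simp
    have hrec : ∀ x ∈ S, x ≠ 0 → ((x.val - (a + 1) + (a + 1) : ℕ) : ZMod k) = x := by
      intro x hx hx0
      rw [Nat.sub_add_cancel (hv x hx hx0).1, ZMod.natCast_zmod_val]
    refine ⟨(S.erase 0).image (fun x => x.val - (a + 1)), ?_, ?_⟩
    · rw [mem_linSets]
      refine ⟨?_, ?_, ?_⟩
      · intro t ht
        obtain ⟨x, hx, rfl⟩ := Finset.mem_image.mp ht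
        rw [Finset.mem_erase] at hx
        have := hv x hx.2 hx.1
        omega
      · rw [Finset.card_image_of_injOn, Finset.card_erase_of_mem h0, hc]
        intro x hx y hy hxy
        rw [Finset.mem_coe, Finset.mem_erase] at hx hy
        rw [← hrec x hx.2 hx.1, ← hrec y hy.2 hy.1]
        exact congrArg (fun t => ((t + (a + 1) : ℕ) : ZMod k)) hxy
      · intro s hs t ht hst
        obtain ⟨x, hx, rfl⟩ := Finset.mem_image.mp hs
        obtain ⟨y, hy, rfl⟩ := Finset.mem_image.mp ht
        rw [Finset.mem_erase] at hx hy
        have hx' := hv x hx.2 hx.1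
        have hy' := hv y hy.2 hy.1
        have hst' : x.val - (a + 1) < y.val - (a + 1) := hst
        by_contra hcon
        refine hg y hy.2 x hx.2 ?_ (y.val - x.val) (by omega) (by omega) ?_
        · rintro rfl
          omega
        · rw [Nat.cast_sub (by omega), ZMod.natCast_zmod_val, ZMod.natCast_zmod_val]
    · ext x
      simp only [Finset.mem_insert, Finset.mem_image, Finset.mem_erase]
      constructor
      · rintro (rfl | ⟨t, ⟨y, ⟨hy0, hy⟩, rfl⟩, rfl⟩)
        · exact h0
        · rw [hrec y hy hy0]
          exact hy
      · intro hx
        by_cases hx0 : x = 0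
        · exact Or.inl hx0
        · exact Or.inr ⟨_, ⟨x, ⟨hx0, hx⟩, rfl⟩, hrec x hx hx0⟩

theorem good_translate {a k : ℕ} [DecidableEq (ZMod k)] {S : Finset (ZMod k)} (h : Good a k S) (c : ZMod k) :
    Good a k (S.image (fun x => x + c)) := by
  intro x hx y hy hxy r h1 h2
  obtain ⟨u, hu, rfl⟩ := Finset.mem_image.mp hx
  obtain ⟨v, hv, rfl⟩ := Finset.mem_image.mp hy
  have := h u hu v hv (by rintro rfl; exact hxy rfl) r h1 h2
  simpa using this

theorem stmt_7 (a n k : ℕ) (ha : 1 ≤ a) (hn : 1 ≤ n) (hk : n * (a + 1) ≤ k) :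
    n * Set.ncard {S : Finset (ZMod k) | S.card = n ∧
        ∀ x ∈ S, ∀ y ∈ S, x ≠ y → ∀ r : ℕ, 1 ≤ r → r ≤ a → x - y ≠ (r : ZMod k)} =
      k * Nat.choose (k - n * a - 1) (n - 1) := by
  classical
  have hak : a + 1 ≤ k := le_trans (Nat.le_mul_of_pos_left _ hn) hk
  haveI : NeZero k := ⟨by omega⟩
  let B : Finset (Finset (ZMod k)) := Finset.univ.filter (fun S => S.card = n ∧ Good a k S)
  have hB : ∀ S, S ∈ B ↔ S.card = n ∧ Good a k S := by
    intro S
    simp [B]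
  have hset : {S : Finset (ZMod k) | S.card = n ∧
        ∀ x ∈ S, ∀ y ∈ S, x ≠ y → ∀ r : ℕ, 1 ≤ r → r ≤ a → x - y ≠ (r : ZMod k)} = (B : Set (Finset (ZMod k))) := by
    ext S
    rw [Finset.mem_coe, hB]
    rfl
  rw [hset, Set.ncard_coe_finset]
  have h0 : (B.filter (fun S => (0 : ZMod k) ∈ S)).card = Nat.choose (k - n * a - 1) (n - 1) := by
    rw [zero_card a n k hn hk _ (fun S => by rw [Finset.mem_filter, hB]), linSets_card]
    obtain ⟨m, rfl⟩ : ∃ m, n = m + 1 := ⟨n - 1, by omega⟩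
    rcases Nat.eq_zero_or_pos m with rfl | hm
    · simp
    · have : 2 * (a + 1) ≤ k := le_trans (Nat.mul_le_mul_right _ (by omega)) hk
      congr 1
      rw [Nat.add_sub_cancel, add_mul, one_mul]
      omega
  have hx : ∀ x : ZMod k, (B.filter (fun S => x ∈ S)).card = Nat.choose (k - n * a - 1) (n - 1) := by
    intro x
    rw [← h0]
    refine Finset.card_bij' (fun S _ => S.image (fun y => y + (-x))) (fun S _ => S.image (fun y => y + x)) ?_ ?_ ?_ ?_
    · intro S hS
      rw [Finset.mem_filter, hB] at hS ⊢
      refine ⟨⟨?_, good_translate hS.1.2 _⟩, Finset.mem_image.mpr ⟨x, hS.2, by simp⟩⟩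
      rw [Finset.card_image_of_injective _ (add_left_injective _), hS.1.1]
    · intro S hS
      rw [Finset.mem_filter, hB] at hS ⊢
      refine ⟨⟨?_, good_translate hS.1.2 _⟩, Finset.mem_image.mpr ⟨0, hS.2, by simp⟩⟩
      rw [Finset.card_image_of_injective _ (add_left_injective _), hS.1.1]
    · intro S _
      rw [Finset.image_image]
      refine Eq.trans (Finset.image_congr (g := id) ?_) Finset.image_id
      intro y _
      simp
    · intro S _
      rw [Finset.image_image]
      refine Eq.trans (Finset.image_congr (g := id) ?_) Finset.image_id
      intro y _
      simp
  have hs := Finset.sum_card hx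
  rw [Finset.sum_congr rfl (fun S hS => ((hB S).mp hS).1), Finset.sum_const, smul_eq_mul, ZMod.card] at hs
  rw [mul_comm, hs]
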